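/- Let H be a Hilbert space and suppose the update function Φ is a contraction in expectation with constant r < 1, i.e. E[‖Φ(x,ξ)−Φ(y,ξ)‖²] ≤ r²‖x−y‖² for all x,y ∈ H. Then Φ is α-firmly nonexpansive in expectation with constant α = (1+r)/2 and no violation: E[‖Φ(x,ξ)−Φ(y,ξ)‖²] ≤ ‖x−y‖² − ((1−r)/(1+r)) E[‖(x−Φ(x,ξ))−(y−Φ(y,ξ))‖²] for all x,y ∈ H; consequently, for all μ₁, μ₂ ∈ P₂(H) and every optimal coupling γ of (μ₁, μ₂), W₂²(μ₁𝒫, μ₂𝒫) ≤ W₂²(μ₁, μ₂) − ((1−r)/(1+r)) ∫_{H×H} E[‖(x−Φ(x,ξ))−(y−Φ(y,ξ))‖²] γ(dx,dy). -/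

import Mathlib

open MeasureTheory Filter Topology

noncomputable section

/-- One application of the dual Markov operator of the RFI, with `μξ` the law of `ξ`. -/
def markovStep {G I : Type*} [MeasurableSpace G] [MeasurableSpace I]
    (μξ : MeasureTheory.Measure I) (T : I → G → G) (μ : MeasureTheory.Measure G) :
    MeasureTheory.Measure G :=
  μ.bind fun x => μξ.map fun i => T i x

/-- Squared distance `‖x - y‖²` as an extended nonnegative real. -/
def q2 {H : Type*} [NormedAddCommGroup H] (x y : H) : ENNReal :=
  (‖x - y‖₊ : ENNReal) ^ 2

/-- `γ` is a coupling of `(μ, ν)`: a measure on the product with marginals `μ` and `ν`. -/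
def IsCoupling {H : Type*} [MeasurableSpace H]
    (γ : MeasureTheory.Measure (H × H)) (μ ν : MeasureTheory.Measure H) : Prop :=
  γ.map Prod.fst = μ ∧ γ.map Prod.snd = ν

/-- The squared Wasserstein-2 distance `W₂(μ,ν)²`. -/
def W2sq {H : Type*} [MeasurableSpace H] [NormedAddCommGroup H]
    (μ ν : MeasureTheory.Measure H) : ENNReal :=
  ⨅ (γ : MeasureTheory.Measure (H × H)) (_ : IsCoupling γ μ ν), ∫⁻ p, q2 p.1 p.2 ∂γ

/-- An optimal coupling of `(μ, ν)`: a coupling attaining `W₂(μ,ν)²`. -/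
def IsOptCoupling {H : Type*} [MeasurableSpace H] [NormedAddCommGroup H]
    (γ : MeasureTheory.Measure (H × H)) (μ ν : MeasureTheory.Measure H) : Prop :=
  IsCoupling γ μ ν ∧ ∫⁻ p, q2 p.1 p.2 ∂γ = W2sq μ ν

/-- Membership in `P₂(H)`: probability measures with finite second moment. -/
def MemP2 {H : Type*} [MeasurableSpace H] [NormedAddCommGroup H]
    (μ : MeasureTheory.Measure H) : Prop :=
  MeasureTheory.IsProbabilityMeasure μ ∧ ∃ x : H, ∫⁻ y, q2 x y ∂μ < ⊤


lemma measurable_q2 {H α : Type*} [NormedAddCommGroup H] [SecondCountableTopology H]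
    [MeasurableSpace H] [BorelSpace H] [MeasurableSpace α] {f g : α → H}
    (hf : Measurable f) (hg : Measurable g) : Measurable fun a => q2 (f a) (g a) :=
  ((hf.sub hg).nnnorm.coe_nnreal_ennreal).pow_const 2

lemma q2_eq_ofReal {H : Type*} [NormedAddCommGroup H] (x y : H) :
    q2 x y = ENNReal.ofReal (‖x - y‖ ^ 2) := by
  rw [q2, ENNReal.ofReal_pow (norm_nonneg _), ofReal_norm]
  rfl

/-- Young's inequality for the squared norm of `(x - x') - (y - y')`. -/
lemma q2_sub_sub_le {H : Type*} [NormedAddCommGroup H] {r : ℝ} (hr : 0 < r) (x y x' y' : H) :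
    q2 (x - x') (y - y') ≤
      ENNReal.ofReal (1 + r) * q2 x y + ENNReal.ofReal (1 + 1 / r) * q2 x' y' := by
  simp only [q2_eq_ofReal]
  rw [← ENNReal.ofReal_mul (by positivity), ← ENNReal.ofReal_mul (by positivity),
    ← ENNReal.ofReal_add (by positivity) (by positivity)]
  apply ENNReal.ofReal_le_ofReal
  have h : ‖(x - x') - (y - y')‖ ≤ ‖x - y‖ + ‖x' - y'‖ := by
    rw [sub_sub_sub_comm]
    exact norm_sub_le _ _
  set a := ‖x - y‖
  set b := ‖x' - y'‖
  have key : (1 + r) * a ^ 2 + (1 + 1 / r) * b ^ 2 - (a + b) ^ 2 = (r * a - b) ^ 2 / r := by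
    field_simp
    ring
  have h0 : 0 ≤ (r * a - b) ^ 2 / r := by positivity
  have h1 := pow_le_pow_left₀ (norm_nonneg _) h 2
  linarith

/-- Minkowski's inequality for the displacements of a contraction in expectation. -/
lemma lintegral_q2_sub_sub_le {H I : Type*} [NormedAddCommGroup H] [SecondCountableTopology H]
    [MeasurableSpace H] [BorelSpace H] [MeasurableSpace I] {μξ : Measure I}
    [IsProbabilityMeasure μξ] {r : ℝ} (hr0 : 0 ≤ r) {x y : H} {f g : I → H}
    (hf : Measurable f) (hg : Measurable g)
    (h : ∫⁻ i, q2 (f i) (g i) ∂μξ ≤ ENNReal.ofReal (r ^ 2) * q2 x y) :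
    ∫⁻ i, q2 (x - f i) (y - g i) ∂μξ ≤ ENNReal.ofReal ((1 + r) ^ 2) * q2 x y := by
  have hm := measurable_q2 hf hg
  rcases hr0.eq_or_lt with rfl | hr
  · have h0 : ∫⁻ i, q2 (f i) (g i) ∂μξ = 0 := by simpa using h
    rw [lintegral_eq_zero_iff hm] at h0
    have : (fun i => q2 (x - f i) (y - g i)) =ᵐ[μξ] fun _ => q2 x y := by
      filter_upwards [h0] with i hi
      have hfg : f i - g i = 0 := by simpa [q2] using hi
      simp [q2, sub_sub_sub_comm, hfg]
    rw [lintegral_congr_ae this]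
    simp
  · calc ∫⁻ i, q2 (x - f i) (y - g i) ∂μξ
        ≤ ∫⁻ i, (ENNReal.ofReal (1 + r) * q2 x y +
            ENNReal.ofReal (1 + 1 / r) * q2 (f i) (g i)) ∂μξ :=
          lintegral_mono fun i => q2_sub_sub_le hr x y (f i) (g i)
      _ = ENNReal.ofReal (1 + r) * q2 x y +
            ENNReal.ofReal (1 + 1 / r) * ∫⁻ i, q2 (f i) (g i) ∂μξ := by
          rw [lintegral_add_left measurable_const, lintegral_const_mul _ hm]
          simp
      _ ≤ ENNReal.ofReal (1 + r) * q2 x y +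
            ENNReal.ofReal (1 + 1 / r) * (ENNReal.ofReal (r ^ 2) * q2 x y) := by gcongr
      _ = ENNReal.ofReal ((1 + r) ^ 2) * q2 x y := by
          rw [← mul_assoc, ← ENNReal.ofReal_mul (by positivity), ← add_mul,
            ← ENNReal.ofReal_add (by positivity) (by positivity)]
          congr 2
          field_simp
          ring

lemma markovStep_eq_map_prod {G I : Type*} [MeasurableSpace G] [MeasurableSpace I]
    {T : I → G → G} (hΦ : Measurable fun p : G × I => T p.2 p.1)
    (μξ : Measure I) [SFinite μξ] (μ : Measure G) [SFinite μ] :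
    markovStep μξ T μ = (μ.prod μξ).map fun p => T p.2 p.1 := by
  have hT (x : G) : Measurable fun i => T i x := hΦ.comp measurable_prodMk_left
  have hK : Measurable fun x => μξ.map fun i => T i x := by
    refine Measure.measurable_of_measurable_coe _ fun s hs => ?_
    simp only [Measure.map_apply (hT _) hs]
    exact measurable_measure_prodMk_left (hΦ hs)
  ext s hs
  rw [markovStep, Measure.bind_apply hs hK.aemeasurable, Measure.map_apply hΦ hs,
    Measure.prod_apply (hΦ hs)]
  exact lintegral_congr fun x => Measure.map_apply (hT x) hs

/-- Driving both components of a coupling with the same noise couples the images under the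
Markov operator. -/
lemma IsCoupling.markovStep {H I : Type*} [MeasurableSpace H] [MeasurableSpace I]
    {T : I → H → H} (hΦ : Measurable fun p : H × I => T p.2 p.1)
    (μξ : Measure I) [SFinite μξ] {γ : Measure (H × H)} [SFinite γ] {μ ν : Measure H}
    (hγ : IsCoupling γ μ ν) :
    IsCoupling ((γ.prod μξ).map fun p => (T p.2 p.1.1, T p.2 p.1.2))
      (markovStep μξ T μ) (markovStep μξ T ν) := by
  have h1 : Measurable fun p : (H × H) × I => T p.2 p.1.1 :=
    hΦ.comp (measurable_fst.fst.prodMk measurable_snd)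
  have h2 : Measurable fun p : (H × H) × I => T p.2 p.1.2 :=
    hΦ.comp (measurable_fst.snd.prodMk measurable_snd)
  have hmarg {π : H × H → H} (hπ : Measurable π) :
      (γ.prod μξ).map (fun p => T p.2 (π p.1)) = _root_.markovStep μξ T (γ.map π) := by
    rw [markovStep_eq_map_prod hΦ]
    conv_rhs => rw [← Measure.map_id (μ := μξ)]
    rw [Measure.map_prod_map _ _ hπ measurable_id, Measure.map_map hΦ (hπ.prodMap measurable_id)]
    rfl
  obtain ⟨rfl, rfl⟩ := hγ
  constructor
  · rw [Measure.map_map measurable_fst (h1.prodMk h2)]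
    exact hmarg measurable_fst
  · rw [Measure.map_map measurable_snd (h1.prodMk h2)]
    exact hmarg measurable_snd

lemma W2sq_markovStep_le {H I : Type*} [NormedAddCommGroup H] [SecondCountableTopology H]
    [MeasurableSpace H] [BorelSpace H] [MeasurableSpace I]
    {T : I → H → H} (hΦ : Measurable fun p : H × I => T p.2 p.1)
    (μξ : Measure I) [SFinite μξ] {γ : Measure (H × H)} [SFinite γ] {μ ν : Measure H}
    (hγ : IsCoupling γ μ ν) :
    W2sq (markovStep μξ T μ) (markovStep μξ T ν) ≤
      ∫⁻ p, ∫⁻ i, q2 (T i p.1) (T i p.2) ∂μξ ∂γ := by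
  have h1 : Measurable fun p : (H × H) × I => T p.2 p.1.1 :=
    hΦ.comp (measurable_fst.fst.prodMk measurable_snd)
  have h2 : Measurable fun p : (H × H) × I => T p.2 p.1.2 :=
    hΦ.comp (measurable_fst.snd.prodMk measurable_snd)
  refine iInf₂_le_of_le _ (hγ.markovStep hΦ μξ) (le_of_eq ?_)
  rw [lintegral_map (measurable_q2 measurable_fst measurable_snd) (h1.prodMk h2),
    lintegral_prod _ (measurable_q2 h1 h2).aemeasurable]

/-- if the update function `Φ(x,i) = T i x` on a Hilbert space is a
contraction in expectation with constant `r < 1`, then `Φ` is α-firmly nonexpansive in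
expectation with constant `α = (1+r)/2` (so `(1-α)/α = (1-r)/(1+r)`) and no violation:
`E[‖Φ(x,ξ)-Φ(y,ξ)‖²] + ((1-r)/(1+r)) E[‖(x-Φ(x,ξ))-(y-Φ(y,ξ))‖²] ≤ ‖x-y‖²`;
consequently, for all `μ₁, μ₂ ∈ P₂(H)` and every optimal coupling `γ` of `(μ₁,μ₂)`,
`W₂²(μ₁𝒫, μ₂𝒫) + ((1-r)/(1+r)) ∫ E[‖(x-Φ(x,ξ))-(y-Φ(y,ξ))‖²] dγ ≤ W₂²(μ₁, μ₂)`. -/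
theorem stmt13
    {H I : Type*} [NormedAddCommGroup H] [InnerProductSpace ℝ H] [CompleteSpace H]
    [SecondCountableTopology H] [MeasurableSpace H] [BorelSpace H] [MeasurableSpace I]
    (T : I → H → H)
    (hΦ : Measurable fun p : H × I => T p.2 p.1)
    (μξ : Measure I) [IsProbabilityMeasure μξ]
    (r : ℝ) (hr0 : 0 ≤ r) (hr1 : r < 1)
    (hcontr : ∀ x y : H,
      ∫⁻ i, q2 (T i x) (T i y) ∂μξ ≤ ENNReal.ofReal (r ^ 2) * q2 x y) :
    (∀ x y : H,
      (∫⁻ i, q2 (T i x) (T i y) ∂μξ) +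
        ENNReal.ofReal ((1 - r) / (1 + r)) * ∫⁻ i, q2 (x - T i x) (y - T i y) ∂μξ ≤
      q2 x y) ∧
    ∀ μ₁ μ₂ : Measure H, MemP2 μ₁ → MemP2 μ₂ →
      ∀ γ : Measure (H × H), IsOptCoupling γ μ₁ μ₂ →
        W2sq (markovStep μξ T μ₁) (markovStep μξ T μ₂) +
          ENNReal.ofReal ((1 - r) / (1 + r)) *
            ∫⁻ p, (∫⁻ i, q2 (p.1 - T i p.1) (p.2 - T i p.2) ∂μξ) ∂γ ≤
        W2sq μ₁ μ₂ := by
  have hT (x : H) : Measurable fun i => T i x := hΦ.comp measurable_prodMk_left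
  have hfirm : ∀ x y : H,
      (∫⁻ i, q2 (T i x) (T i y) ∂μξ) +
        ENNReal.ofReal ((1 - r) / (1 + r)) * ∫⁻ i, q2 (x - T i x) (y - T i y) ∂μξ ≤
      q2 x y := by
    intro x y
    have hc : 0 ≤ (1 - r) / (1 + r) := div_nonneg (by linarith) (by linarith)
    calc _ ≤ ENNReal.ofReal (r ^ 2) * q2 x y + ENNReal.ofReal ((1 - r) / (1 + r)) *
          (ENNReal.ofReal ((1 + r) ^ 2) * q2 x y) := by
          gcongr
          · exact hcontr x y
          · exact lintegral_q2_sub_sub_le hr0 (hT x) (hT y) (hcontr x y)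
      _ = q2 x y := by
          rw [← mul_assoc, ← ENNReal.ofReal_mul hc, ← add_mul,
            ← ENNReal.ofReal_add (by positivity) (by positivity)]
          have : r ^ 2 + (1 - r) / (1 + r) * (1 + r) ^ 2 = 1 := by
            field_simp
            ring
          simp [this]
  refine ⟨hfirm, fun μ₁ μ₂ hμ₁ _ γ hγ => ?_⟩
  have : IsFiniteMeasure γ := by
    have := hμ₁.1
    rw [← hγ.1.1] at this
    exact ⟨by simpa [Measure.map_apply measurable_fst] using measure_lt_top (γ.map Prod.fst) .univ⟩
  have h1 : Measurable fun p : (H × H) × I => T p.2 p.1.1 :=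
    hΦ.comp (measurable_fst.fst.prodMk measurable_snd)
  have h2 : Measurable fun p : (H × H) × I => T p.2 p.1.2 :=
    hΦ.comp (measurable_fst.snd.prodMk measurable_snd)
  rw [← hγ.2]
  calc _ ≤ (∫⁻ p, ∫⁻ i, q2 (T i p.1) (T i p.2) ∂μξ ∂γ) +
        ENNReal.ofReal ((1 - r) / (1 + r)) *
          ∫⁻ p, (∫⁻ i, q2 (p.1 - T i p.1) (p.2 - T i p.2) ∂μξ) ∂γ := by
        gcongr
        exact W2sq_markovStep_le hΦ μξ hγ.1
    _ = ∫⁻ p, ((∫⁻ i, q2 (T i p.1) (T i p.2) ∂μξ) + ENNReal.ofReal ((1 - r) / (1 + r)) *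
          ∫⁻ i, q2 (p.1 - T i p.1) (p.2 - T i p.2) ∂μξ) ∂γ := by
        rw [lintegral_add_left (measurable_q2 h1 h2).lintegral_prod_right',
          lintegral_const_mul' _ _ ENNReal.ofReal_ne_top]
    _ ≤ ∫⁻ p, q2 p.1 p.2 ∂γ := lintegral_mono fun p => hfirm p.1 p.2
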